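/- Let m ≥ 2 be a natural number and let (A,+,·) be a left brace with A^{(3)} = {0} and A^{m+1} = {0}. Let a ∈ A and define a_1 = a, a_{j+1} = a*a_j for j ≥ 1. Then for every k with 1 ≤ k ≤ m−1, (−a)*a_{m−k} = ∑_{j=1}^k (−1)^j a_{m−k+j}. -/

import Mathlib

/-- `λ_a(b) = -a + a·b` for a left-brace multiplication `mul`. -/
def braceLam {A : Type*} [AddCommGroup A] (mul : A → A → A) (a b : A) : A :=
  -a + mul a b

/-- The star operation `a * b = λ_a(b) - b`. -/
def braceStar {A : Type*} [AddCommGroup A] (mul : A → A → A) (a b : A) : A :=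
  braceLam mul a b - b

/-- `rightSeries mul r` is `A^{(r+1)}` of the paper: `rightSeries mul 0 = A^{(1)} = A` and
`rightSeries mul (r+1) = A^{(r+2)} = A^{(r+1)} * A`, the additive subgroup generated by
star products of elements of `A^{(r+1)}` with elements of `A`. -/
def rightSeries {A : Type*} [AddCommGroup A] (mul : A → A → A) : ℕ → AddSubgroup A
  | 0 => ⊤
  | r + 1 => AddSubgroup.closure {x | ∃ z c, z ∈ rightSeries mul r ∧ x = braceStar mul z c}

/-- `leftSeries mul r` is `A^{r+1}` of the paper: `leftSeries mul 0 = A^1 = A` and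
`leftSeries mul (r+1) = A^{r+2} = A * A^{r+1}`, the additive subgroup generated by
star products of elements of `A` with elements of `A^{r+1}`. -/
def leftSeries {A : Type*} [AddCommGroup A] (mul : A → A → A) : ℕ → AddSubgroup A
  | 0 => ⊤
  | r + 1 => AddSubgroup.closure {x | ∃ c z, z ∈ leftSeries mul r ∧ x = braceStar mul c z}

/-- `λ_a` is additive. -/
theorem braceLam_add {A : Type*} [AddCommGroup A] {mul : A → A → A}
    (hdist : ∀ a b c : A, mul a (b + c) = mul a b - a + mul a c) (a b c : A) :
    braceLam mul a (b + c) = braceLam mul a b + braceLam mul a c := by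
  simp only [braceLam, hdist]
  abel

/-- `λ_a` as an additive endomorphism. -/
def braceLamHom {A : Type*} [AddCommGroup A] (mul : A → A → A)
    (hdist : ∀ a b c : A, mul a (b + c) = mul a b - a + mul a c) (a : A) : A →+ A :=
  AddMonoidHom.mk' (braceLam mul a) (braceLam_add hdist a)

/-- `a ↦ λ_a` is multiplicative. -/
theorem braceLam_mul {A : Type*} [AddCommGroup A] {mul : A → A → A}
    (hassoc : ∀ a b c : A, mul (mul a b) c = mul a (mul b c))
    (hdist : ∀ a b c : A, mul a (b + c) = mul a b - a + mul a c) (a b c : A) :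
    braceLam mul (mul a b) c = braceLam mul a (braceLam mul b c) := by
  have h : mul a (mul b c) = mul a b - a + mul a (-b + mul b c) := by
    rw [← hdist, add_neg_cancel_left]
  simp only [braceLam, hassoc, h]
  abel

/-- If `A^{(3)} = 0` then `λ_{-a}` is a left inverse of `λ_a`. -/
theorem braceLam_neg_braceLam {A : Type*} [AddCommGroup A] {mul : A → A → A}
    (hassoc : ∀ a b c : A, mul (mul a b) c = mul a (mul b c))
    (hdist : ∀ a b c : A, mul a (b + c) = mul a b - a + mul a c)
    (h3 : rightSeries mul 2 = ⊥) (a x : A) :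
    braceLam mul (-a) (braceLam mul a x) = x := by
  have hz : mul (-a) a = braceStar mul (-a) a := by
    simp only [braceStar, braceLam]
    abel
  have hmem : braceStar mul (-a) a ∈ rightSeries mul 1 :=
    AddSubgroup.subset_closure ⟨-a, a, AddSubgroup.mem_top _, rfl⟩
  have h0 : braceStar mul (braceStar mul (-a) a) x ∈ rightSeries mul 2 :=
    AddSubgroup.subset_closure ⟨_, x, hmem, rfl⟩
  rw [h3, AddSubgroup.mem_bot] at h0
  rw [← braceLam_mul hassoc hdist, hz]
  exact sub_eq_zero.mp h0

/-- Iterated star products by `a` descend along the left series. -/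
theorem mem_leftSeries_of_star {A : Type*} [AddCommGroup A] {mul : A → A → A} {a : A}
    {f : ℕ → A} (hf : ∀ j : ℕ, 1 ≤ j → f (j + 1) = braceStar mul a (f j)) (j : ℕ) :
    f (j + 1) ∈ leftSeries mul j := by
  induction j with
  | zero => exact AddSubgroup.mem_top _
  | succ j ih => exact AddSubgroup.subset_closure ⟨a, _, ih, hf _ (by omega)⟩

/-- `λ_a` telescopes on the alternating sum of iterated star products by `a`. -/
theorem braceLam_alternating_sum {A : Type*} [AddCommGroup A] {mul : A → A → A}
    (hdist : ∀ a b c : A, mul a (b + c) = mul a b - a + mul a c) {a : A}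
    {f : ℕ → A} (hf : ∀ j : ℕ, 1 ≤ j → f (j + 1) = braceStar mul a (f j))
    {n : ℕ} (hn : 1 ≤ n) (k : ℕ) :
    braceLam mul a (f n + ∑ j ∈ Finset.Icc 1 k, ((-1 : ℤ) ^ j) • f (n + j)) =
      f n + ((-1 : ℤ) ^ k) • f (n + k + 1) := by
  have hlam : ∀ i, 1 ≤ i → braceLam mul a (f i) = f i + f (i + 1) := fun i hi => by
    rw [hf i hi, braceStar, add_sub_cancel]
  induction k with
  | zero => simp [hlam n hn]
  | succ k ih =>
    have hs : braceLam mul a (((-1 : ℤ) ^ (k + 1)) • f (n + (k + 1))) =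
        ((-1 : ℤ) ^ (k + 1)) • braceLam mul a (f (n + (k + 1))) :=
      map_zsmul (braceLamHom mul hdist a) _ _
    rw [Finset.sum_Icc_succ_top (by omega), ← add_assoc, braceLam_add hdist, ih, hs,
      hlam _ (by omega), pow_succ, smul_add, ← add_assoc n k 1]
    simp

/-- Let `m ≥ 2`, `A` a left brace with `A^{(3)} = {0}` and `A^{m+1} = {0}`,
`a ∈ A`, `a_1 = a`, `a_{j+1} = a * a_j`.  Then for `1 ≤ k ≤ m - 1`,
`(-a) * a_{m-k} = ∑_{j=1}^k (-1)^j a_{m-k+j}`. -/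
theorem stmt12 {A : Type*} [AddCommGroup A] (m : ℕ) (hm : 2 ≤ m)
    (mul : A → A → A)
    (hassoc : ∀ a b c : A, mul (mul a b) c = mul a (mul b c))
    (hzl : ∀ a : A, mul 0 a = a)
    (hzr : ∀ a : A, mul a 0 = a)
    (hinv : ∀ a : A, ∃ b : A, mul a b = 0 ∧ mul b a = 0)
    (hdist : ∀ a b c : A, mul a (b + c) = mul a b - a + mul a c)
    (h3 : rightSeries mul 2 = ⊥) (hL : leftSeries mul m = ⊥)
    (a : A) (f : ℕ → A) (hf1 : f 1 = a)
    (hf : ∀ j : ℕ, 1 ≤ j → f (j + 1) = braceStar mul a (f j)) :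
    ∀ k : ℕ, 1 ≤ k → k ≤ m - 1 →
      braceStar mul (-a) (f (m - k)) =
        ∑ j ∈ Finset.Icc 1 k, ((-1 : ℤ) ^ j) • f (m - k + j) := by
  intro k _ hkm
  have hn : 1 ≤ m - k := by omega
  have hlast : f (m - k + k + 1) = 0 := by
    have h := mem_leftSeries_of_star hf m
    rw [hL, AddSubgroup.mem_bot] at h
    rwa [Nat.sub_add_cancel (by omega)]
  have htel := braceLam_alternating_sum hdist hf hn k
  rw [hlast, smul_zero, add_zero] at htel
  have hinverse := braceLam_neg_braceLam hassoc hdist h3 a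
    (f (m - k) + ∑ j ∈ Finset.Icc 1 k, ((-1 : ℤ) ^ j) • f (m - k + j))
  rw [htel] at hinverse
  rw [braceStar, hinverse, add_sub_cancel_left]
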